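/- Let R > 0 and let μ ∈ ℝ with −3 < μ < 1. Then there exist constants c₀ > 0 and λ₀ ≥ 0 such that for every u : ℝ² → ℂ that is C² on an open neighborhood of the closed ball {x : ‖x‖ ≤ R}, the Gårding inequality holds: ∫_{B_R} ( μ·‖Δu(x)‖² + (1 − μ)·Σᵢⱼ ‖∂ᵢ(∂ⱼu)(x)‖² ) dx + λ₀·∫_{B_R} ‖u(x)‖² dx ≥ c₀·∫_{B_R} ( ‖u(x)‖² + Σᵢ ‖∂ᵢu(x)‖² + Σᵢⱼ ‖∂ᵢ(∂ⱼu)(x)‖² ) dx, where B_R := {x ∈ ℝ² : ‖x‖ < R} and the sums run over i, j ∈ {1, 2}. (This is the Gårding inequality a(u,u) + λ₀‖u‖²_{L²(B_R)} ≥ c₀‖u‖²_{H²(B_R)} for the plate energy form, restricted to smooth functions.) -/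

import Mathlib

noncomputable section

open MeasureTheory Filter

/-- The plane `ℝ²`. -/
local notation "E2" => EuclideanSpace ℝ (Fin 2)

/-- Partial derivative in the direction of the `i`-th standard basis vector. -/
def pd (i : Fin 2) (u : EuclideanSpace ℝ (Fin 2) → ℂ) (x : EuclideanSpace ℝ (Fin 2)) : ℂ :=
  fderiv ℝ u x (EuclideanSpace.single i 1)

/-- The Laplacian `Δu = ∂₁∂₁u + ∂₂∂₂u`. -/
def lap (u : EuclideanSpace ℝ (Fin 2) → ℂ) (x : EuclideanSpace ℝ (Fin 2)) : ℂ :=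
  pd 0 (pd 0 u) x + pd 1 (pd 1 u) x

/-- The components of a single angular Fourier mode of the 2-jet of a function on the plane in the
polar frame: `v` is the value, `(p, q)` the gradient and `(a, b, d)` the Hessian
(radial-radial, radial-angular and angular-angular entries). -/
structure IsPolarMode (n : ℤ) (v p q a b d : ℝ → ℂ) : Prop where
  cont_a : Continuous a
  cont_b : Continuous b
  cont_d : Continuous d
  deriv_v : ∀ r, HasDerivAt v (p r) r
  deriv_p : ∀ r, HasDerivAt p (a r) r
  deriv_q : ∀ r, HasDerivAt q (b r) r
  angular_v : ∀ r : ℝ, (r : ℂ) * q r = Complex.I * n * v r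
  angular_p : ∀ r : ℝ, (r : ℂ) * b r = Complex.I * n * p r - q r
  angular_q : ∀ r : ℝ, (r : ℂ) * d r = Complex.I * n * q r + p r

lemma Complex.sq_norm_eq (z : ℂ) : ‖z‖ ^ 2 = z.re ^ 2 + z.im ^ 2 := by
  rw [Complex.sq_norm, Complex.normSq_apply]; ring

lemma HasDerivAt.complex_re {f : ℝ → ℂ} {f' : ℂ} {r : ℝ} (h : HasDerivAt f f' r) :
    HasDerivAt (fun s => (f s).re) f'.re r :=
  Complex.reCLM.hasFDerivAt.comp_hasDerivAt r h

lemma HasDerivAt.complex_im {f : ℝ → ℂ} {f' : ℂ} {r : ℝ} (h : HasDerivAt f f' r) :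
    HasDerivAt (fun s => (f s).im) f'.im r :=
  Complex.imCLM.hasFDerivAt.comp_hasDerivAt r h

lemma sub_le_integral_of_deriv_le {R : ℝ} (hR : 0 < R) {P P' φ : ℝ → ℝ}
    (hP : ∀ r, HasDerivAt P (P' r) r) (hφ : Continuous φ)
    (hle : ∀ r ∈ Set.Ioo 0 R, P' r ≤ φ r) : P R - P 0 ≤ ∫ r in (0 : ℝ)..R, φ r :=
  intervalIntegral.sub_le_integral_of_hasDeriv_right_of_le hR.le
    (fun r _ => (hP r).continuousAt.continuousWithinAt) (fun r _ => (hP r).hasDerivWithinAt)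
    (hφ.continuousOn.integrableOn_compact isCompact_Icc) hle

namespace IsPolarMode

variable {n : ℤ} {v p q a b d : ℝ → ℂ}

lemma continuous_v (h : IsPolarMode n v p q a b d) : Continuous v :=
  continuous_iff_continuousAt.2 fun r => (h.deriv_v r).continuousAt

lemma continuous_p (h : IsPolarMode n v p q a b d) : Continuous p :=
  continuous_iff_continuousAt.2 fun r => (h.deriv_p r).continuousAt

lemma continuous_q (h : IsPolarMode n v p q a b d) : Continuous q :=
  continuous_iff_continuousAt.2 fun r => (h.deriv_q r).continuousAt

lemma angular_v_re (h : IsPolarMode n v p q a b d) (r : ℝ) : r * (q r).re = -(n * (v r).im) := by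
  simpa using congrArg Complex.re (h.angular_v r)

lemma angular_v_im (h : IsPolarMode n v p q a b d) (r : ℝ) : r * (q r).im = n * (v r).re := by
  simpa using congrArg Complex.im (h.angular_v r)

lemma angular_p_re (h : IsPolarMode n v p q a b d) (r : ℝ) :
    r * (b r).re = -(n * (p r).im) - (q r).re := by
  simpa using congrArg Complex.re (h.angular_p r)

lemma angular_p_im (h : IsPolarMode n v p q a b d) (r : ℝ) :
    r * (b r).im = n * (p r).re - (q r).im := by
  simpa using congrArg Complex.im (h.angular_p r)

lemma angular_q_re (h : IsPolarMode n v p q a b d) (r : ℝ) :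
    r * (d r).re = -(n * (q r).im) + (p r).re := by
  simpa using congrArg Complex.re (h.angular_q r)

lemma angular_q_im (h : IsPolarMode n v p q a b d) (r : ℝ) :
    r * (d r).im = n * (q r).re + (p r).im := by
  simpa using congrArg Complex.im (h.angular_q r)

lemma critical_form_nonneg (h : IsPolarMode n v p q a b d) {R : ℝ} (hR : 0 < R)
    {σ : ℝ} (hσ : σ ^ 2 = 1) (hn : 1 ≤ σ * n) :
    0 ≤ ∫ r in (0 : ℝ)..R,
      r * (4 * (‖a r‖ ^ 2 + 2 * ‖b r‖ ^ 2 + ‖d r‖ ^ 2) - 3 * ‖a r + d r‖ ^ 2) := by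
  have ca := h.cont_a
  have cb := h.cont_b
  have cd := h.cont_d
  have key := sub_le_integral_of_deriv_le hR
    (P := fun r => 2 * (σ * n - 1) *
      (((p r).re + σ * (q r).im) ^ 2 + ((p r).im - σ * (q r).re) ^ 2))
    (P' := fun r => 2 * (σ * n - 1) *
      (2 * ((p r).re + σ * (q r).im) * ((a r).re + σ * (b r).im)
        + 2 * ((p r).im - σ * (q r).re) * ((a r).im - σ * (b r).re)))
    (φ := fun r => r * (4 * (‖a r‖ ^ 2 + 2 * ‖b r‖ ^ 2 + ‖d r‖ ^ 2) - 3 * ‖a r + d r‖ ^ 2))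
    (fun r => ?_) (by fun_prop) (fun r hr => ?_)
  · refine le_trans ?_ key
    have h1 := h.angular_p_re 0
    have h2 := h.angular_p_im 0
    have h3 := h.angular_q_re 0
    have h4 := h.angular_q_im 0
    have e1 : (σ * n - 1) * ((p 0).re + σ * (q 0).im) = 0 := by
      linear_combination -σ * h2 + h3 + n * (q 0).im * hσ
    have e2 : (σ * n - 1) * ((p 0).im - σ * (q 0).re) = 0 := by
      linear_combination σ * h1 + h4 - n * (q 0).re * hσ
    have e3 : 2 * (σ * n - 1) * (((p 0).re + σ * (q 0).im) ^ 2 + ((p 0).im - σ * (q 0).re) ^ 2)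
        = 0 := by
      linear_combination 2 * ((p 0).re + σ * (q 0).im) * e1 + 2 * ((p 0).im - σ * (q 0).re) * e2
    simp only [e3, sub_zero]
    have : 0 ≤ σ * n - 1 := by linarith
    positivity
  · have d1 := (h.deriv_p r).complex_re
    have d2 := (h.deriv_p r).complex_im
    have d3 := (h.deriv_q r).complex_re
    have d4 := (h.deriv_q r).complex_im
    refine ((((d1.add (d4.const_mul σ)).pow 2).add ((d2.sub (d3.const_mul σ)).pow 2)).const_mul
      (2 * (σ * n - 1))).congr_deriv ?_
    simp
  · have h1 := h.angular_p_re r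
    have h2 := h.angular_p_im r
    have h3 := h.angular_q_re r
    have h4 := h.angular_q_im r
    have e1 : (σ * n - 1) * ((p r).re + σ * (q r).im) = -r * ((d r).re - σ * (b r).im) := by
      linear_combination -σ * h2 + h3 + n * (q r).im * hσ
    have e2 : (σ * n - 1) * ((p r).im - σ * (q r).re) = -r * ((d r).im + σ * (b r).re) := by
      linear_combination σ * h1 + h4 - n * (q r).re * hσ
    have hr0 : 0 ≤ r := hr.1.le
    have : 0 ≤ r * (((a r).re - (d r).re - 2 * σ * (b r).im) ^ 2
        + ((a r).im - (d r).im + 2 * σ * (b r).re) ^ 2) := by positivity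
    simp only [Complex.sq_norm_eq, Complex.add_re, Complex.add_im]
    refine le_of_sub_nonneg (this.trans_eq ?_)
    linear_combination 4 * ((a r).re + σ * (b r).im) * e1 + 4 * ((a r).im - σ * (b r).re) * e2
      + 8 * r * ((b r).re ^ 2 + (b r).im ^ 2) * hσ

lemma critical_form_zero_ge (h : IsPolarMode 0 v p q a b d) {R : ℝ} (hR : 0 < R) :
    0 ≤ ∫ r in (0 : ℝ)..R,
      r * (4 * (‖a r‖ ^ 2 + 2 * ‖b r‖ ^ 2 + ‖d r‖ ^ 2) - 3 * ‖a r + d r‖ ^ 2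
        + 1000 * R⁻¹ ^ 4 * ‖v r‖ ^ 2) := by
  have ca := h.cont_a
  have cb := h.cont_b
  have cd := h.cont_d
  have cv := h.continuous_v
  set i : ℝ := R⁻¹ with hi
  have hiR : R * i = 1 := mul_inv_cancel₀ hR.ne'
  set c₁ : ℝ := (p R).re with hc₁
  set c₂ : ℝ := (p R).im with hc₂
  have key := sub_le_integral_of_deriv_le hR
    (P := fun r => -3 * ((p r).re ^ 2 + (p r).im ^ 2)
      + 8 * (c₁ * ((6 * (r * i) ^ 5 - 5 * (r * i) ^ 6) * (p r).re
            - 30 * i * ((r * i) ^ 4 - (r * i) ^ 5) * (v r).re)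
          + c₂ * ((6 * (r * i) ^ 5 - 5 * (r * i) ^ 6) * (p r).im
            - 30 * i * ((r * i) ^ 4 - (r * i) ^ 5) * (v r).im)
          - (c₁ ^ 2 + c₂ ^ 2) *
            (2 * (36 / 10 * (r * i) ^ 10 - 60 / 11 * (r * i) ^ 11 + 25 / 12 * (r * i) ^ 12)
              + 1 / 500 * (2400 * (r * i) ^ 6 - 36000 / 7 * (r * i) ^ 7
                + 22500 / 8 * (r * i) ^ 8))))
    (P' := fun r => -6 * ((p r).re * (a r).re + (p r).im * (a r).im)
      + 8 * (c₁ * ((6 * (r * i) ^ 5 - 5 * (r * i) ^ 6) * (a r).re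
            - i ^ 2 * (120 * (r * i) ^ 3 - 150 * (r * i) ^ 4) * (v r).re)
          + c₂ * ((6 * (r * i) ^ 5 - 5 * (r * i) ^ 6) * (a r).im
            - i ^ 2 * (120 * (r * i) ^ 3 - 150 * (r * i) ^ 4) * (v r).im)
          - (c₁ ^ 2 + c₂ ^ 2) * i * (r * i) *
            (2 * (6 * (r * i) ^ 4 - 5 * (r * i) ^ 5) ^ 2
              + 1 / 500 * (120 * (r * i) ^ 2 - 150 * (r * i) ^ 3) ^ 2)))
    (φ := fun r => r * (4 * (‖a r‖ ^ 2 + 2 * ‖b r‖ ^ 2 + ‖d r‖ ^ 2) - 3 * ‖a r + d r‖ ^ 2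
        + 1000 * i ^ 4 * ‖v r‖ ^ 2))
    (fun r => ?_) (by fun_prop) (fun r hr => ?_)
  · refine le_trans ?_ key
    simp only [hiR, ← hc₁, ← hc₂]
    ring_nf
    positivity
  · have d1 := (h.deriv_p r).complex_re
    have d2 := (h.deriv_p r).complex_im
    have d3 := (h.deriv_v r).complex_re
    have d4 := (h.deriv_v r).complex_im
    have s (k : ℕ) : HasDerivAt (fun r : ℝ => (r * i) ^ k) (k * (r * i) ^ (k - 1) * (1 * i)) r :=
      ((hasDerivAt_id r).mul_const i).pow k
    have ψ₀ := ((s 5).const_mul 6).sub ((s 6).const_mul 5)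
    have ψ₁ := ((s 4).sub (s 5)).const_mul (30 * i)
    have w₀ := ((((s 10).const_mul (36 / 10)).sub ((s 11).const_mul (60 / 11))).add
      ((s 12).const_mul (25 / 12))).const_mul 2
    have w₁ := ((((s 6).const_mul 2400).sub ((s 7).const_mul (36000 / 7))).add
      ((s 8).const_mul (22500 / 8))).const_mul (1 / 500)
    refine ((((d1.pow 2).add (d2.pow 2)).const_mul (-3)).add
      ((((((ψ₀.mul d1).sub (ψ₁.mul d3)).const_mul c₁).add
        (((ψ₀.mul d2).sub (ψ₁.mul d4)).const_mul c₂)).sub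
        ((w₀.add w₁).const_mul (c₁ ^ 2 + c₂ ^ 2))).const_mul 8)).congr_deriv ?_
    norm_num
    ring
  · have h3 := h.angular_q_re r
    have h4 := h.angular_q_im r
    simp only [Int.cast_zero, zero_mul, neg_zero, zero_add] at h3 h4
    have hr0 : 0 ≤ r := hr.1.le
    have : 0 ≤ r * (((a r).re - 4 * i * (6 * (r * i) ^ 4 - 5 * (r * i) ^ 5) * c₁) ^ 2
        + ((a r).im - 4 * i * (6 * (r * i) ^ 4 - 5 * (r * i) ^ 5) * c₂) ^ 2
        + (d r).re ^ 2 + (d r).im ^ 2 + 8 * ((b r).re ^ 2 + (b r).im ^ 2)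
        + 8 / 500 * ((i * (120 * (r * i) ^ 2 - 150 * (r * i) ^ 3) * c₁
              + 250 * i ^ 2 * (v r).re) ^ 2
          + (i * (120 * (r * i) ^ 2 - 150 * (r * i) ^ 3) * c₂ + 250 * i ^ 2 * (v r).im) ^ 2)) := by
      positivity
    simp only [Complex.sq_norm_eq, Complex.add_re, Complex.add_im, ← h3, ← h4]
    refine le_of_sub_nonneg (this.trans_eq ?_)
    ring

lemma critical_form_ge (h : IsPolarMode n v p q a b d) {R : ℝ} (hR : 0 < R) :
    0 ≤ ∫ r in (0 : ℝ)..R,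
      r * (4 * (‖a r‖ ^ 2 + 2 * ‖b r‖ ^ 2 + ‖d r‖ ^ 2) - 3 * ‖a r + d r‖ ^ 2
        + 1000 * R⁻¹ ^ 4 * ‖v r‖ ^ 2) := by
  have ca := h.cont_a
  have cb := h.cont_b
  have cd := h.cont_d
  have cv := h.continuous_v
  rcases eq_or_ne n 0 with rfl | hn
  · exact h.critical_form_zero_ge hR
  obtain ⟨σ, hσ, hσn⟩ : ∃ σ : ℝ, σ ^ 2 = 1 ∧ 1 ≤ σ * n := by
    rcases lt_or_gt_of_ne hn with hn | hn
    · exact ⟨-1, by norm_num, by have : (n : ℝ) ≤ -1 := by exact_mod_cast Int.le_sub_one_of_lt hn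
                                 linarith⟩
    · exact ⟨1, by norm_num, by have : (1 : ℝ) ≤ n := by exact_mod_cast hn
                                linarith⟩
  refine (h.critical_form_nonneg hR hσ hσn).trans
    (intervalIntegral.integral_mono_on hR.le
      (Continuous.intervalIntegrable (by fun_prop) _ _)
      (Continuous.intervalIntegrable (by fun_prop) _ _) fun r hr => ?_)
  have := hr.1
  gcongr
  simp only [le_add_iff_nonneg_right]
  positivity

lemma gradient_le (h : IsPolarMode n v p q a b d) {R : ℝ} (hR : 0 < R) :
    0 ≤ ∫ r in (0 : ℝ)..R,
      r * (12 * R⁻¹ ^ 2 * ‖v r‖ ^ 2 + 5 * R ^ 2 * (‖a r‖ ^ 2 + 2 * ‖b r‖ ^ 2 + ‖d r‖ ^ 2)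
        - (‖p r‖ ^ 2 + ‖q r‖ ^ 2)) := by
  have ca := h.cont_a
  have cb := h.cont_b
  have cd := h.cont_d
  have cv := h.continuous_v
  have cp := h.continuous_p
  have cq := h.continuous_q
  set i : ℝ := R⁻¹ with hi
  have hiR : R * i = 1 := mul_inv_cancel₀ hR.ne'
  by_cases hn : n ^ 2 = 1
  · have hN : (n : ℝ) ^ 2 = 1 := by exact_mod_cast hn
    have key := sub_le_integral_of_deriv_le hR
      (P := fun r => -3 * ((r ^ 2 - i ^ 2 * r ^ 4) * ((q r).re ^ 2 + (q r).im ^ 2)))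
      (P' := fun r => -3 * ((2 * r - 4 * i ^ 2 * r ^ 3) * ((q r).re ^ 2 + (q r).im ^ 2)
        + 2 * (r ^ 2 - i ^ 2 * r ^ 4) * ((q r).re * (b r).re + (q r).im * (b r).im)))
      (φ := fun r => r * (12 * i ^ 2 * ‖v r‖ ^ 2
        + 5 * R ^ 2 * (‖a r‖ ^ 2 + 2 * ‖b r‖ ^ 2 + ‖d r‖ ^ 2) - (‖p r‖ ^ 2 + ‖q r‖ ^ 2)))
      (fun r => ?_) (by fun_prop) (fun r hr => ?_)
    · refine le_of_eq_of_le ?_ key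
      linear_combination -3 * R ^ 2 * ((q R).re ^ 2 + (q R).im ^ 2) * (R * i + 1) * hiR
    · have d3 := (h.deriv_q r).complex_re
      have d4 := (h.deriv_q r).complex_im
      refine ((((hasDerivAt_pow 2 r).sub ((hasDerivAt_pow 4 r).const_mul (i ^ 2))).mul
        ((d3.pow 2).add (d4.pow 2))).const_mul (-3)).congr_deriv ?_
      norm_num
      ring
    · have h1 := h.angular_p_re r
      have h2 := h.angular_p_im r
      have h5 := h.angular_v_re r
      have h6 := h.angular_v_im r
      have hr0 : 0 ≤ r := hr.1.le
      have hv : (v r).re ^ 2 + (v r).im ^ 2 = r ^ 2 * ((q r).re ^ 2 + (q r).im ^ 2) := by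
        linear_combination (-(r * (q r).re) + n * (v r).im) * h5
          - (r * (q r).im + n * (v r).re) * h6 - ((v r).re ^ 2 + (v r).im ^ 2) * hN
      have hp : (p r).re ^ 2 + (p r).im ^ 2
          = ((q r).re + r * (b r).re) ^ 2 + ((q r).im + r * (b r).im) ^ 2 := by
        linear_combination (-(r * (b r).re + (q r).re) + n * (p r).im) * h1
          - (r * (b r).im + (q r).im + n * (p r).re) * h2 - ((p r).re ^ 2 + (p r).im ^ 2) * hN
      have hri : 0 ≤ (r * i) ^ 2 ∧ (r * i) ^ 2 ≤ 1 := by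
        refine ⟨by positivity, ?_⟩
        have : 0 < i := inv_pos.2 hR
        have : r * i ≤ 1 := by rw [← hiR]; gcongr; exact hr.2.le
        exact pow_le_one₀ (by positivity) this
      have hk : (4 - 6 * (r * i) ^ 2) ^ 2 ≤ 16 := by nlinarith [hri.1, hri.2]
      have hrR : r ^ 2 ≤ R ^ 2 := by gcongr; exact hr.2.le
      have hk2 : 0 ≤ 10 * R ^ 2 - r ^ 2 - (4 - 6 * (r * i) ^ 2) ^ 2 / 16 * r ^ 2 := by
        nlinarith [sq_nonneg r]
      have : 0 ≤ r * (5 * R ^ 2 * ((a r).re ^ 2 + (a r).im ^ 2 + (d r).re ^ 2 + (d r).im ^ 2)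
          + (2 * (q r).re + (4 - 6 * (r * i) ^ 2) / 4 * r * (b r).re) ^ 2
          + (2 * (q r).im + (4 - 6 * (r * i) ^ 2) / 4 * r * (b r).im) ^ 2
          + (10 * R ^ 2 - r ^ 2 - (4 - 6 * (r * i) ^ 2) ^ 2 / 16 * r ^ 2)
            * ((b r).re ^ 2 + (b r).im ^ 2)) := by positivity
      simp only [Complex.sq_norm_eq, hv, hp]
      refine le_of_sub_nonneg (this.trans_eq ?_)
      ring
  · refine intervalIntegral.integral_nonneg hR.le fun r hr => mul_nonneg hr.1 ?_
    have h1 := h.angular_p_re r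
    have h2 := h.angular_p_im r
    have h3 := h.angular_q_re r
    have h4 := h.angular_q_im r
    have hN : 0 < ((n : ℝ) ^ 2 - 1) ^ 2 ∧ 2 * (1 + (n : ℝ) ^ 2) ≤ 5 * ((n : ℝ) ^ 2 - 1) ^ 2 := by
      have : n ^ 2 = 0 ∨ 4 ≤ n ^ 2 := by
        by_cases h0 : n = 0
        · simp [h0]
        · right
          have : n ≠ 1 := by rintro rfl; simp at hn
          have : n ≠ -1 := by rintro rfl; simp at hn
          rcases lt_or_gt_of_ne h0 with h0 | h0
          · have : n ≤ -2 := by omega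
            nlinarith
          · have : 2 ≤ n := by omega
            nlinarith
      rcases this with h0 | h0
      · have h0 : (n : ℝ) ^ 2 = 0 := by exact_mod_cast h0
        norm_num [h0]
      · have h0 : 4 ≤ (n : ℝ) ^ 2 := by exact_mod_cast h0
        constructor <;> nlinarith
    have e1 : ((n : ℝ) ^ 2 - 1) * (p r).re = - r * ((d r).re - n * (b r).im) := by
      linear_combination h3 - n * h2
    have e2 : ((n : ℝ) ^ 2 - 1) * (p r).im = - r * ((d r).im + n * (b r).re) := by
      linear_combination h4 + n * h1
    have e3 : ((n : ℝ) ^ 2 - 1) * (q r).re = r * (n * (d r).im + (b r).re) := by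
      linear_combination -n * h4 - h1
    have e4 : ((n : ℝ) ^ 2 - 1) * (q r).im = - r * (n * (d r).re - (b r).im) := by
      linear_combination n * h3 - h2
    have hrR : r ^ 2 ≤ R ^ 2 := by gcongr; exacts [hr.1, hr.2]
    have hB : 0 ≤ ‖b r‖ ^ 2 + ‖d r‖ ^ 2 := by positivity
    have hmain : ((n : ℝ) ^ 2 - 1) ^ 2 * (‖p r‖ ^ 2 + ‖q r‖ ^ 2)
        ≤ ((n : ℝ) ^ 2 - 1) ^ 2 * (5 * R ^ 2 * (‖b r‖ ^ 2 + ‖d r‖ ^ 2)) := by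
      calc ((n : ℝ) ^ 2 - 1) ^ 2 * (‖p r‖ ^ 2 + ‖q r‖ ^ 2)
          = r ^ 2 * (((d r).re - n * (b r).im) ^ 2 + ((d r).im + n * (b r).re) ^ 2
              + (n * (d r).im + (b r).re) ^ 2 + (n * (d r).re - (b r).im) ^ 2) := by
            simp only [Complex.sq_norm_eq]
            rw [mul_add, mul_add, mul_add, ← mul_pow, ← mul_pow, ← mul_pow, ← mul_pow,
              e1, e2, e3, e4]
            ring
        _ ≤ r ^ 2 * (2 * (1 + (n : ℝ) ^ 2) * (‖b r‖ ^ 2 + ‖d r‖ ^ 2)) := by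
            gcongr
            simp only [Complex.sq_norm_eq]
            refine le_of_sub_nonneg (le_of_le_of_eq (b := ((d r).re + n * (b r).im) ^ 2
              + ((d r).im - n * (b r).re) ^ 2 + (n * (d r).im - (b r).re) ^ 2
              + (n * (d r).re + (b r).im) ^ 2) (by positivity) (by ring))
        _ ≤ R ^ 2 * (5 * ((n : ℝ) ^ 2 - 1) ^ 2 * (‖b r‖ ^ 2 + ‖d r‖ ^ 2)) := by
            exact mul_le_mul hrR (mul_le_mul_of_nonneg_right hN.2 hB) (by positivity)
              (by positivity)
        _ = _ := by ring
    have hpq := le_of_mul_le_mul_left hmain hN.1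
    have : 0 ≤ 12 * i ^ 2 * ‖v r‖ ^ 2 + 5 * R ^ 2 * (‖a r‖ ^ 2 + ‖b r‖ ^ 2) := by positivity
    linarith

end IsPolarMode

/-- The `n`-th Fourier coefficient of a function of the angle `θ ∈ (-π, π)`. -/
def angularCoeff (n : ℤ) (f : ℝ → ℂ) : ℂ :=
  (2 * Real.pi : ℂ)⁻¹ * ∫ θ in (-Real.pi)..Real.pi, Complex.exp (-(Complex.I * n * θ)) * f θ

lemma angularCoeff_add (n : ℤ) {f g : ℝ → ℂ} (hf : Continuous f) (hg : Continuous g) :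
    angularCoeff n (fun θ => f θ + g θ) = angularCoeff n f + angularCoeff n g := by
  simp only [angularCoeff, mul_add]
  rw [intervalIntegral.integral_add (Continuous.intervalIntegrable (by fun_prop) _ _)
    (Continuous.intervalIntegrable (by fun_prop) _ _), mul_add]

lemma angularCoeff_const_mul (n : ℤ) (c : ℂ) (f : ℝ → ℂ) :
    angularCoeff n (fun θ => c * f θ) = c * angularCoeff n f := by
  simp only [angularCoeff, mul_left_comm _ c, intervalIntegral.integral_const_mul]

lemma hasSum_sq_norm_angularCoeff {f : ℝ → ℂ} (hf : Continuous f) :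
    HasSum (fun n : ℤ => ‖angularCoeff n f‖ ^ 2)
      ((2 * Real.pi)⁻¹ * ∫ θ in (-Real.pi)..Real.pi, ‖f θ‖ ^ 2) := by
  have hab : -Real.pi < Real.pi := neg_lt_self Real.pi_pos
  have hL2 : MemLp f 2 (volume.restrict (Set.Ioc (-Real.pi) Real.pi)) := by
    obtain ⟨C, hC⟩ := (isCompact_Icc (a := -Real.pi) (b := Real.pi)).exists_bound_of_continuousOn
      hf.continuousOn
    refine MemLp.of_bound hf.aestronglyMeasurable C ?_
    filter_upwards [ae_restrict_mem measurableSet_Ioc] with x hx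
    exact hC x (Set.Ioc_subset_Icc_self hx)
  have h := hasSum_sq_fourierCoeffOn hab hL2
  have hpi : Real.pi - -Real.pi = 2 * Real.pi := by ring
  have hcoeff : ∀ n, fourierCoeffOn hab f n = angularCoeff n f := fun n => by
    rw [fourierCoeffOn_eq_integral, angularCoeff, hpi, Complex.real_smul]
    push_cast
    rw [one_div]
    congr 1
    refine intervalIntegral.integral_congr fun θ _ => ?_
    simp only [fourier_coe_apply, smul_eq_mul]
    congr 2
    have : (Real.pi : ℂ) ≠ 0 := by exact_mod_cast Real.pi_ne_zero
    push_cast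
    field_simp
  simpa only [hcoeff, hpi, smul_eq_mul] using h

lemma continuous_angularCoeff (n : ℤ) {F : ℝ → ℝ → ℂ} (hF : Continuous (Function.uncurry F)) :
    Continuous fun r => angularCoeff n (F r) := by
  unfold angularCoeff
  refine continuous_const.mul
    (intervalIntegral.continuous_parametric_intervalIntegral_of_continuous' ?_ _ _)
  have : Continuous fun x : ℝ × ℝ => F x.1 x.2 := hF
  simp only [Function.uncurry_def]
  fun_prop

lemma hasDerivAt_angularCoeff (n : ℤ) {F F' : ℝ → ℝ → ℂ} (hF : Continuous (Function.uncurry F))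
    (hF' : Continuous (Function.uncurry F'))
    (hd : ∀ r θ, HasDerivAt (fun s => F s θ) (F' r θ) r) (r : ℝ) :
    HasDerivAt (fun s => angularCoeff n (F s)) (angularCoeff n (F' r)) r := by
  have hFr : ∀ s, Continuous (F s) := fun s => hF.comp (Continuous.prodMk_right s)
  have hFr' : ∀ s, Continuous (F' s) := fun s => hF'.comp (Continuous.prodMk_right s)
  obtain ⟨C, hC⟩ := ((isCompact_closedBall r 1).prod
    (isCompact_Icc (a := -Real.pi) (b := Real.pi))).exists_bound_of_continuousOn
      (f := fun x : ℝ × ℝ => Complex.exp (-(Complex.I * n * x.2)) * F' x.1 x.2)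
      (Continuous.continuousOn (by
        have : Continuous fun x : ℝ × ℝ => F' x.1 x.2 := hF'
        fun_prop))
  refine HasDerivAt.const_mul _ (intervalIntegral.hasDerivAt_integral_of_dominated_loc_of_deriv_le
    (bound := fun _ => C)
    (F' := fun s θ => Complex.exp (-(Complex.I * n * θ)) * F' s θ)
    (Metric.closedBall_mem_nhds r one_pos) (.of_forall fun s => ?_) ?_ ?_ ?_ (by simp) ?_).2
  · have := hFr s
    exact Continuous.aestronglyMeasurable (by fun_prop)
  · have := hFr r
    exact Continuous.intervalIntegrable (by fun_prop) _ _
  · have := hFr' r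
    exact Continuous.aestronglyMeasurable (by fun_prop)
  · refine .of_forall fun θ hθ s hs => hC (s, θ) ⟨hs, ?_⟩
    rw [Set.uIoc_of_le (neg_le_self Real.pi_pos.le)] at hθ
    exact Set.Ioc_subset_Icc_self hθ
  · exact .of_forall fun θ _ s _ => (hd s θ).const_mul _

lemma angularCoeff_deriv (n : ℤ) {f f' : ℝ → ℂ} (hd : ∀ θ, HasDerivAt f (f' θ) θ)
    (hf' : Continuous f') (hper : f (-Real.pi) = f Real.pi) :
    angularCoeff n f' = Complex.I * n * angularCoeff n f := by
  have hexp : ∀ θ : ℝ, HasDerivAt (fun θ : ℝ => Complex.exp (-(Complex.I * n * θ)))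
      (Complex.exp (-(Complex.I * n * θ)) * -(Complex.I * n)) θ := fun θ => by
    simpa using (((hasDerivAt_id θ).ofReal_comp.const_mul (Complex.I * n)).neg).cexp
  have hf : Continuous f := continuous_iff_continuousAt.2 fun θ => (hd θ).continuousAt
  have hbd : Complex.exp (-(Complex.I * n * (Real.pi : ℝ)))
      = Complex.exp (-(Complex.I * n * (-Real.pi : ℝ))) := by
    rw [Complex.exp_eq_exp_iff_exists_int]
    exact ⟨-n, by push_cast; ring⟩
  have h := intervalIntegral.integral_mul_deriv_eq_deriv_mul (a := -Real.pi) (b := Real.pi)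
    (fun θ _ => hexp θ) (fun θ _ => hd θ) (Continuous.intervalIntegrable (by fun_prop) _ _)
    (hf'.intervalIntegrable _ _)
  rw [angularCoeff, angularCoeff, h, hbd, hper, sub_self, zero_sub,
    ← intervalIntegral.integral_neg, mul_left_comm (Complex.I * n),
    ← intervalIntegral.integral_const_mul (Complex.I * n)]
  congr 1
  refine intervalIntegral.integral_congr fun θ _ => ?_
  ring

lemma hasSum_integral_sq_norm_angularCoeff {R : ℝ} (hR : 0 < R) {F : ℝ → ℝ → ℂ}
    (hF : Continuous (Function.uncurry F)) :
    HasSum (fun n : ℤ => ∫ r in (0 : ℝ)..R, r * ‖angularCoeff n (F r)‖ ^ 2)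
      (∫ r in (0 : ℝ)..R, r * ((2 * Real.pi)⁻¹ * ∫ θ in (-Real.pi)..Real.pi, ‖F r θ‖ ^ 2)) := by
  have hsum : ∀ r, HasSum (fun n : ℤ => r * ‖angularCoeff n (F r)‖ ^ 2)
      (r * ((2 * Real.pi)⁻¹ * ∫ θ in (-Real.pi)..Real.pi, ‖F r θ‖ ^ 2)) := fun r =>
    (hasSum_sq_norm_angularCoeff (hF.comp (Continuous.prodMk_right r))).mul_left r
  refine intervalIntegral.hasSum_integral_of_dominated_convergence
    (fun n r => r * ‖angularCoeff n (F r)‖ ^ 2) (fun n => ?_) (fun n => ?_)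
    (.of_forall fun r _ => (hsum r).summable) ?_ (.of_forall fun r _ => hsum r)
  · have := continuous_angularCoeff n hF
    exact Continuous.aestronglyMeasurable (by fun_prop)
  · refine .of_forall fun r hr => ?_
    rw [Set.uIoc_of_le hR.le] at hr
    have := hr.1.le
    rw [Real.norm_of_nonneg (by positivity)]
  · simp only [fun r => (hsum r).tsum_eq]
    refine Continuous.intervalIntegrable (continuous_id.mul (continuous_const.mul
      (intervalIntegral.continuous_parametric_intervalIntegral_of_continuous' ?_ _ _))) _ _
    exact hF.norm.pow 2

/-- Polar coordinates as a map into the Euclidean plane. -/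
def polarPoint (r θ : ℝ) : EuclideanSpace ℝ (Fin 2) := !₂[r * Real.cos θ, r * Real.sin θ]

lemma polarPoint_eq (r θ : ℝ) : polarPoint r θ =
    (r * Real.cos θ) • EuclideanSpace.single 0 1 + (r * Real.sin θ) • EuclideanSpace.single 1 1 := by
  ext i
  fin_cases i <;> simp [polarPoint]

lemma continuous_polarPoint : Continuous (Function.uncurry polarPoint) := by
  simp only [Function.uncurry_def, polarPoint_eq]
  fun_prop

lemma norm_polarPoint {r : ℝ} (hr : 0 ≤ r) (θ : ℝ) : ‖polarPoint r θ‖ = r := by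
  rw [EuclideanSpace.norm_eq, Real.sqrt_eq_iff_mul_self_eq (by positivity) hr]
  simp only [polarPoint, Fin.sum_univ_two, Real.norm_eq_abs, sq_abs]
  simp
  linear_combination r ^ 2 * Real.sin_sq_add_cos_sq θ

lemma integral_ball_eq_polar {R : ℝ} (hR : 0 < R) {g : EuclideanSpace ℝ (Fin 2) → ℝ}
    (hg : Continuous g) :
    ∫ x in Metric.ball 0 R, g x =
      ∫ r in (0 : ℝ)..R, r * ∫ θ in (-Real.pi)..Real.pi, g (polarPoint r θ) := by
  have hpt : ∀ p : ℝ × ℝ, (WithLp.toLp 2 ((MeasurableEquiv.finTwoArrow (α := ℝ)).symm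
      (polarCoord.symm p)) : EuclideanSpace ℝ (Fin 2)) = polarPoint p.1 p.2 := fun p => by
    ext i
    fin_cases i <;> simp [polarPoint, polarCoord]
  have hmp := (PiLp.volume_preserving_toLp (Fin 2)).comp (volume_preserving_finTwoArrow ℝ).symm
  have hemb : MeasurableEmbedding (WithLp.toLp 2 ∘ (MeasurableEquiv.finTwoArrow (α := ℝ)).symm :
      ℝ × ℝ → EuclideanSpace ℝ (Fin 2)) :=
    (MeasurableEquiv.toLp 2 (Fin 2 → ℝ)).measurableEmbedding.comp
      (MeasurableEquiv.finTwoArrow (α := ℝ)).symm.measurableEmbedding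
  rw [← integral_indicator measurableSet_ball, ← hmp.integral_comp hemb,
    ← integral_comp_polarCoord_symm]
  have hind : ∀ p ∈ polarCoord.target,
      p.1 • (Metric.ball (0 : EuclideanSpace ℝ (Fin 2)) R).indicator g
        ((WithLp.toLp 2 ∘ (MeasurableEquiv.finTwoArrow (α := ℝ)).symm) (polarCoord.symm p))
      = (Set.Ioo 0 R ×ˢ Set.Ioo (-Real.pi) Real.pi).indicator
          (fun p : ℝ × ℝ => p.1 * g (polarPoint p.1 p.2)) p := by
    rintro ⟨r, θ⟩ ⟨hr, hθ⟩
    have hr : 0 < r := hr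
    rw [Function.comp_apply, hpt]
    have hmem : (r, θ) ∈ Set.Ioo 0 R ×ˢ Set.Ioo (-Real.pi) Real.pi
        ↔ polarPoint r θ ∈ Metric.ball (0 : EuclideanSpace ℝ (Fin 2)) R := by
      rw [mem_ball_zero_iff, norm_polarPoint hr.le]
      exact ⟨fun h => h.1.2, fun h => ⟨⟨hr, h⟩, hθ⟩⟩
    by_cases h : polarPoint r θ ∈ Metric.ball (0 : EuclideanSpace ℝ (Fin 2)) R
    · rw [Set.indicator_of_mem h, Set.indicator_of_mem (hmem.2 h), smul_eq_mul]
    · rw [Set.indicator_of_notMem h, Set.indicator_of_notMem (fun h' => h (hmem.1 h')), smul_zero]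
  have hsub : Set.Ioo 0 R ×ˢ Set.Ioo (-Real.pi) Real.pi ⊆ polarCoord.target :=
    Set.prod_mono (fun r hr => hr.1) subset_rfl
  have hcont : Continuous fun p : ℝ × ℝ => p.1 * g (polarPoint p.1 p.2) :=
    continuous_fst.mul (hg.comp continuous_polarPoint)
  rw [setIntegral_congr_fun polarCoord.open_target.measurableSet hind,
    setIntegral_indicator (measurableSet_Ioo.prod measurableSet_Ioo),
    Set.inter_eq_self_of_subset_right hsub, Measure.volume_eq_prod, setIntegral_prod]
  · rw [intervalIntegral.integral_of_le hR.le, integral_Ioc_eq_integral_Ioo]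
    refine setIntegral_congr_fun measurableSet_Ioo fun r _ => ?_
    simp only
    rw [integral_const_mul, intervalIntegral.integral_of_le (neg_le_self Real.pi_pos.le),
      integral_Ioc_eq_integral_Ioo]
  · rw [← Measure.volume_eq_prod]
    exact (hcont.continuousOn.integrableOn_compact (isCompact_Icc.prod isCompact_Icc)).mono_set
      (Set.prod_mono Set.Ioo_subset_Icc_self Set.Ioo_subset_Icc_self)

lemma integral_ball_nonneg_of_angularCoeff {R : ℝ} (hR : 0 < R) {m : ℕ} (c : Fin m → ℝ)
    {F : Fin m → ℝ → ℝ → ℂ} (hF : ∀ i, Continuous (Function.uncurry (F i)))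
    {g : EuclideanSpace ℝ (Fin 2) → ℝ} (hg : Continuous g)
    (hgF : ∀ r θ, g (polarPoint r θ) = ∑ i, c i * ‖F i r θ‖ ^ 2)
    (hmode : ∀ n : ℤ, 0 ≤ ∫ r in (0 : ℝ)..R, r * ∑ i, c i * ‖angularCoeff n (F i r)‖ ^ 2) :
    0 ≤ ∫ x in Metric.ball 0 R, g x := by
  have hsum := hasSum_sum (s := Finset.univ) fun i _ =>
    (hasSum_integral_sq_norm_angularCoeff hR (hF i)).mul_left (c i)
  have hcoeff : ∀ n : ℤ,
      ∑ i, c i * (∫ r in (0 : ℝ)..R, r * ‖angularCoeff n (F i r)‖ ^ 2)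
        = ∫ r in (0 : ℝ)..R, r * ∑ i, c i * ‖angularCoeff n (F i r)‖ ^ 2 := fun n => by
    simp only [Finset.mul_sum, ← intervalIntegral.integral_const_mul]
    rw [intervalIntegral.integral_finsetSum]
    · exact Finset.sum_congr rfl fun i _ =>
        intervalIntegral.integral_congr fun r _ => by simp only [mul_left_comm]
    · intro i _
      have := continuous_angularCoeff n (hF i)
      exact Continuous.intervalIntegrable (by fun_prop) _ _
  have hcirc : ∀ i, Continuous fun r => ∫ θ in (-Real.pi)..Real.pi, ‖F i r θ‖ ^ 2 := fun i =>
    intervalIntegral.continuous_parametric_intervalIntegral_of_continuous' ((hF i).norm.pow 2) _ _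
  have htotal : ∑ i, c i * (∫ r in (0 : ℝ)..R,
      r * ((2 * Real.pi)⁻¹ * ∫ θ in (-Real.pi)..Real.pi, ‖F i r θ‖ ^ 2))
        = (2 * Real.pi)⁻¹ * ∫ x in Metric.ball 0 R, g x := by
    rw [integral_ball_eq_polar hR hg, ← intervalIntegral.integral_const_mul]
    simp only [← intervalIntegral.integral_const_mul (c _)]
    rw [← intervalIntegral.integral_finsetSum]
    · refine intervalIntegral.integral_congr fun r _ => ?_
      simp only [hgF]
      rw [intervalIntegral.integral_finsetSum]
      · simp only [intervalIntegral.integral_const_mul, Finset.mul_sum]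
        exact Finset.sum_congr rfl fun i _ => by ring
      · intro i _
        have := (hF i).comp (Continuous.prodMk_right r)
        exact (continuous_const.mul (this.norm.pow 2)).intervalIntegrable _ _
    · intro i _
      have := hcirc i
      exact Continuous.intervalIntegrable (by fun_prop) _ _
  rw [htotal] at hsum
  have h0 := hsum.nonneg fun n => (hcoeff n).symm ▸ hmode n
  exact nonneg_of_mul_nonneg_right h0 (by positivity)

lemma continuous_pd_of_contDiff {u : E2 → ℂ} (hu : ContDiff ℝ 1 u) (i : Fin 2) :
    Continuous (pd i u) :=
  (hu.continuous_fderiv one_ne_zero).clm_apply continuous_const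

lemma contDiff_pd {u : E2 → ℂ} (hu : ContDiff ℝ 2 u) (i : Fin 2) : ContDiff ℝ 1 (pd i u) :=
  (hu.fderiv_right (by norm_num)).clm_apply contDiff_const

lemma pd_comm {u : E2 → ℂ} (hu : ContDiff ℝ 2 u) (i j : Fin 2) (x : E2) :
    pd i (pd j u) x = pd j (pd i u) x := by
  have hd : DifferentiableAt ℝ (fderiv ℝ u) x :=
    (hu.fderiv_right (m := 1) (by norm_num)).differentiable (by norm_num) x
  have key : ∀ k l : Fin 2, pd k (pd l u) x = fderiv ℝ (fderiv ℝ u) x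
      (EuclideanSpace.single k 1) (EuclideanSpace.single l 1) := fun k l => by
    have := (hd.hasFDerivAt.clm_apply
      (hasFDerivAt_const (EuclideanSpace.single l (1 : ℝ)) x)).fderiv
    change fderiv ℝ (fun y => fderiv ℝ u y (EuclideanSpace.single l 1)) x _ = _
    rw [this]
    simp
  rw [key, key]
  exact (hu.contDiffAt.isSymmSndFDerivAt (by simp)).eq _ _

lemma fderiv_apply_eq_pd (u : E2 → ℂ) (x : E2) (α β : ℝ) :
    fderiv ℝ u x (α • EuclideanSpace.single 0 1 + β • EuclideanSpace.single 1 1)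
      = α * pd 0 u x + β * pd 1 u x := by
  simp [pd]

lemma hasDerivAt_comp_polarPoint_radial {w : E2 → ℂ} (hw : ContDiff ℝ 1 w) (r θ : ℝ) :
    HasDerivAt (fun s => w (polarPoint s θ))
      (Real.cos θ * pd 0 w (polarPoint r θ) + Real.sin θ * pd 1 w (polarPoint r θ)) r := by
  rw [← fderiv_apply_eq_pd]
  refine ((hw.differentiable one_ne_zero _).hasFDerivAt).comp_hasDerivAt r ?_
  simp only [polarPoint_eq]
  exact ((hasDerivAt_mul_const _).smul_const _).add ((hasDerivAt_mul_const _).smul_const _)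

lemma hasDerivAt_comp_polarPoint_angular {w : E2 → ℂ} (hw : ContDiff ℝ 1 w) (r θ : ℝ) :
    HasDerivAt (fun t => w (polarPoint r t))
      (r * (-Real.sin θ * pd 0 w (polarPoint r θ) + Real.cos θ * pd 1 w (polarPoint r θ))) θ := by
  have : (r * (-Real.sin θ * pd 0 w (polarPoint r θ) + Real.cos θ * pd 1 w (polarPoint r θ)) : ℂ)
      = fderiv ℝ w (polarPoint r θ) ((r * -Real.sin θ) • EuclideanSpace.single 0 1
        + (r * Real.cos θ) • EuclideanSpace.single 1 1) := by
    rw [fderiv_apply_eq_pd]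
    push_cast
    ring
  rw [this]
  refine ((hw.differentiable one_ne_zero _).hasFDerivAt).comp_hasDerivAt θ ?_
  rw [show polarPoint r = _ from funext (polarPoint_eq r)]
  exact (((Real.hasDerivAt_cos θ).const_mul r).smul_const _).add
    (((Real.hasDerivAt_sin θ).const_mul r).smul_const _)

/-- The radial component of the covector field `f₀ dx₀ + f₁ dx₁` in the polar frame. -/
def radialPart (f₀ f₁ : E2 → ℂ) (r θ : ℝ) : ℂ :=
  Real.cos θ * f₀ (polarPoint r θ) + Real.sin θ * f₁ (polarPoint r θ)

/-- The angular component of the covector field `f₀ dx₀ + f₁ dx₁` in the polar frame. -/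
def angularPart (f₀ f₁ : E2 → ℂ) (r θ : ℝ) : ℂ :=
  -Real.sin θ * f₀ (polarPoint r θ) + Real.cos θ * f₁ (polarPoint r θ)

/-- The double-radial component of the Hessian of `u` in the polar frame. -/
def hessRadial (u : E2 → ℂ) (r θ : ℝ) : ℂ :=
  Real.cos θ * radialPart (pd 0 (pd 0 u)) (pd 1 (pd 0 u)) r θ
    + Real.sin θ * radialPart (pd 0 (pd 1 u)) (pd 1 (pd 1 u)) r θ

/-- The mixed component of the Hessian of `u` in the polar frame. -/
def hessMixed (u : E2 → ℂ) (r θ : ℝ) : ℂ :=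
  -Real.sin θ * radialPart (pd 0 (pd 0 u)) (pd 1 (pd 0 u)) r θ
    + Real.cos θ * radialPart (pd 0 (pd 1 u)) (pd 1 (pd 1 u)) r θ

/-- The double-angular component of the Hessian of `u` in the polar frame. -/
def hessAngular (u : E2 → ℂ) (r θ : ℝ) : ℂ :=
  -Real.sin θ * angularPart (pd 0 (pd 0 u)) (pd 1 (pd 0 u)) r θ
    + Real.cos θ * angularPart (pd 0 (pd 1 u)) (pd 1 (pd 1 u)) r θ

lemma continuous_radialPart {f₀ f₁ : E2 → ℂ} (h₀ : Continuous f₀) (h₁ : Continuous f₁) :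
    Continuous (Function.uncurry (radialPart f₀ f₁)) := by
  have h := continuous_polarPoint
  have h₀ : Continuous fun x : ℝ × ℝ => f₀ (polarPoint x.1 x.2) := h₀.comp h
  have h₁ : Continuous fun x : ℝ × ℝ => f₁ (polarPoint x.1 x.2) := h₁.comp h
  simp only [Function.uncurry_def, radialPart]
  fun_prop

lemma continuous_angularPart {f₀ f₁ : E2 → ℂ} (h₀ : Continuous f₀) (h₁ : Continuous f₁) :
    Continuous (Function.uncurry (angularPart f₀ f₁)) := by
  have h := continuous_polarPoint
  have h₀ : Continuous fun x : ℝ × ℝ => f₀ (polarPoint x.1 x.2) := h₀.comp h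
  have h₁ : Continuous fun x : ℝ × ℝ => f₁ (polarPoint x.1 x.2) := h₁.comp h
  simp only [Function.uncurry_def, angularPart]
  fun_prop

lemma continuous_pd_pd {u : E2 → ℂ} (hu : ContDiff ℝ 2 u) (i j : Fin 2) :
    Continuous (pd i (pd j u)) :=
  continuous_pd_of_contDiff (contDiff_pd hu j) i

lemma continuous_hessRadial {u : E2 → ℂ} (hu : ContDiff ℝ 2 u) :
    Continuous (Function.uncurry (hessRadial u)) := by
  have h₀ := continuous_radialPart (continuous_pd_pd hu 0 0) (continuous_pd_pd hu 1 0)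
  have h₁ := continuous_radialPart (continuous_pd_pd hu 0 1) (continuous_pd_pd hu 1 1)
  simp only [Function.uncurry_def, hessRadial] at *
  fun_prop

lemma continuous_hessMixed {u : E2 → ℂ} (hu : ContDiff ℝ 2 u) :
    Continuous (Function.uncurry (hessMixed u)) := by
  have h₀ := continuous_radialPart (continuous_pd_pd hu 0 0) (continuous_pd_pd hu 1 0)
  have h₁ := continuous_radialPart (continuous_pd_pd hu 0 1) (continuous_pd_pd hu 1 1)
  simp only [Function.uncurry_def, hessMixed] at *
  fun_prop

lemma continuous_hessAngular {u : E2 → ℂ} (hu : ContDiff ℝ 2 u) :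
    Continuous (Function.uncurry (hessAngular u)) := by
  have h₀ := continuous_angularPart (continuous_pd_pd hu 0 0) (continuous_pd_pd hu 1 0)
  have h₁ := continuous_angularPart (continuous_pd_pd hu 0 1) (continuous_pd_pd hu 1 1)
  simp only [Function.uncurry_def, hessAngular] at *
  fun_prop

lemma hasDerivAt_radialPart_radial {u : E2 → ℂ} (hu : ContDiff ℝ 2 u) (r θ : ℝ) :
    HasDerivAt (fun s => radialPart (pd 0 u) (pd 1 u) s θ) (hessRadial u r θ) r :=
  ((hasDerivAt_comp_polarPoint_radial (contDiff_pd hu 0) r θ).const_mul _).add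
    ((hasDerivAt_comp_polarPoint_radial (contDiff_pd hu 1) r θ).const_mul _)

lemma hasDerivAt_angularPart_radial {u : E2 → ℂ} (hu : ContDiff ℝ 2 u) (r θ : ℝ) :
    HasDerivAt (fun s => angularPart (pd 0 u) (pd 1 u) s θ) (hessMixed u r θ) r :=
  ((hasDerivAt_comp_polarPoint_radial (contDiff_pd hu 0) r θ).const_mul _).add
    ((hasDerivAt_comp_polarPoint_radial (contDiff_pd hu 1) r θ).const_mul _)

lemma hasDerivAt_radialPart_angular {u : E2 → ℂ} (hu : ContDiff ℝ 2 u) (r θ : ℝ) :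
    HasDerivAt (fun t => radialPart (pd 0 u) (pd 1 u) r t)
      (angularPart (pd 0 u) (pd 1 u) r θ + r * hessMixed u r θ) θ := by
  have h := ((Real.hasDerivAt_cos θ).ofReal_comp.mul
    (hasDerivAt_comp_polarPoint_angular (contDiff_pd hu 0) r θ)).add
      ((Real.hasDerivAt_sin θ).ofReal_comp.mul
    (hasDerivAt_comp_polarPoint_angular (contDiff_pd hu 1) r θ))
  refine h.congr_deriv ?_
  simp only [hessMixed, radialPart, angularPart, pd_comm hu 1 0]
  push_cast
  ring

lemma hasDerivAt_angularPart_angular {u : E2 → ℂ} (hu : ContDiff ℝ 2 u) (r θ : ℝ) :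
    HasDerivAt (fun t => angularPart (pd 0 u) (pd 1 u) r t)
      (-1 * radialPart (pd 0 u) (pd 1 u) r θ + r * hessAngular u r θ) θ := by
  have h := ((Real.hasDerivAt_sin θ).ofReal_comp.neg.mul
    (hasDerivAt_comp_polarPoint_angular (contDiff_pd hu 0) r θ)).add
      ((Real.hasDerivAt_cos θ).ofReal_comp.mul
    (hasDerivAt_comp_polarPoint_angular (contDiff_pd hu 1) r θ))
  refine h.congr_deriv ?_
  simp only [hessAngular, radialPart, angularPart, pd_comm hu 1 0, Pi.neg_apply]
  push_cast
  ring

lemma isPolarMode_angularCoeff {u : E2 → ℂ} (hu : ContDiff ℝ 2 u) (n : ℤ) :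
    IsPolarMode n (fun r => angularCoeff n fun θ => u (polarPoint r θ))
      (fun r => angularCoeff n (radialPart (pd 0 u) (pd 1 u) r))
      (fun r => angularCoeff n (angularPart (pd 0 u) (pd 1 u) r))
      (fun r => angularCoeff n (hessRadial u r)) (fun r => angularCoeff n (hessMixed u r))
      (fun r => angularCoeff n (hessAngular u r)) := by
  have hu1 : ContDiff ℝ 1 u := hu.of_le one_le_two
  have cv : Continuous (Function.uncurry fun r θ => u (polarPoint r θ)) :=
    hu.continuous.comp continuous_polarPoint
  have c₀ := continuous_pd_of_contDiff hu1 0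
  have c₁ := continuous_pd_of_contDiff hu1 1
  have cp := continuous_radialPart c₀ c₁
  have cq := continuous_angularPart c₀ c₁
  have ca := continuous_hessRadial hu
  have cb := continuous_hessMixed hu
  have cd := continuous_hessAngular hu
  have hpt : ∀ r, polarPoint r (-Real.pi) = polarPoint r Real.pi := fun r => by simp [polarPoint]
  have hr : ∀ {G : ℝ → ℝ → ℂ} (_ : Continuous (Function.uncurry G)) (r : ℝ), Continuous (G r) :=
    fun hG r => hG.comp (Continuous.prodMk_right r)
  have hmul : ∀ {f : ℝ → ℂ} (_ : Continuous f) (z : ℂ), Continuous fun θ => z * f θ :=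
    fun hf z => continuous_const.mul hf
  refine ⟨continuous_angularCoeff n ca, continuous_angularCoeff n cb, continuous_angularCoeff n cd,
    hasDerivAt_angularCoeff n cv cp fun r θ => hasDerivAt_comp_polarPoint_radial hu1 r θ,
    hasDerivAt_angularCoeff n cp ca (hasDerivAt_radialPart_radial hu),
    hasDerivAt_angularCoeff n cq cb (hasDerivAt_angularPart_radial hu),
    fun r => ?_, fun r => ?_, fun r => ?_⟩
  · rw [← angularCoeff_const_mul]
    exact angularCoeff_deriv n (hasDerivAt_comp_polarPoint_angular hu1 r) (hmul (hr cq r) r)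
      (by rw [hpt])
  · rw [eq_sub_iff_add_eq', ← angularCoeff_const_mul,
      ← angularCoeff_add n (hr cq r) (hmul (hr cb r) r)]
    exact angularCoeff_deriv n (hasDerivAt_radialPart_angular hu r)
      ((hr cq r).add (hmul (hr cb r) r)) (by simp [radialPart, hpt])
  · rw [← sub_eq_iff_eq_add, sub_eq_neg_add, ← neg_one_mul, ← angularCoeff_const_mul,
      ← angularCoeff_const_mul, ← angularCoeff_add n (hmul (hr cp r) _) (hmul (hr cd r) r)]
    exact angularCoeff_deriv n (hasDerivAt_angularPart_angular hu r)
      ((hmul (hr cp r) _).add (hmul (hr cd r) r)) (by simp [angularPart, hpt])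

/-- The squared Frobenius norm of the Hessian. -/
def hessSq (u : E2 → ℂ) (x : E2) : ℝ := ∑ i : Fin 2, ∑ j : Fin 2, ‖pd i (pd j u) x‖ ^ 2

/-- The squared norm of the gradient. -/
def gradSq (u : E2 → ℂ) (x : E2) : ℝ := ∑ i : Fin 2, ‖pd i u x‖ ^ 2

lemma Complex.sq_norm_rotate (θ : ℝ) (z w : ℂ) :
    ‖Real.cos θ * z + Real.sin θ * w‖ ^ 2 + ‖-Real.sin θ * z + Real.cos θ * w‖ ^ 2
      = ‖z‖ ^ 2 + ‖w‖ ^ 2 := by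
  simp only [Complex.sq_norm_eq]
  simp only [← Complex.ofReal_neg, Complex.add_re, Complex.add_im, Complex.re_ofReal_mul,
    Complex.im_ofReal_mul]
  linear_combination (z.re ^ 2 + z.im ^ 2 + w.re ^ 2 + w.im ^ 2) * Real.sin_sq_add_cos_sq θ

lemma gradSq_polarPoint (u : E2 → ℂ) (r θ : ℝ) : gradSq u (polarPoint r θ)
    = ‖radialPart (pd 0 u) (pd 1 u) r θ‖ ^ 2 + ‖angularPart (pd 0 u) (pd 1 u) r θ‖ ^ 2 := by
  rw [radialPart, angularPart, Complex.sq_norm_rotate, gradSq, Fin.sum_univ_two]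

lemma hessMixed_eq {u : E2 → ℂ} (hu : ContDiff ℝ 2 u) (r θ : ℝ) : hessMixed u r θ =
    Real.cos θ * angularPart (pd 0 (pd 0 u)) (pd 1 (pd 0 u)) r θ
    + Real.sin θ * angularPart (pd 0 (pd 1 u)) (pd 1 (pd 1 u)) r θ := by
  simp only [hessMixed, radialPart, angularPart, pd_comm hu 1 0]
  ring

lemma hessSq_polarPoint {u : E2 → ℂ} (hu : ContDiff ℝ 2 u) (r θ : ℝ) : hessSq u (polarPoint r θ)
    = ‖hessRadial u r θ‖ ^ 2 + 2 * ‖hessMixed u r θ‖ ^ 2 + ‖hessAngular u r θ‖ ^ 2 := by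
  have h1 := Complex.sq_norm_rotate θ (radialPart (pd 0 (pd 0 u)) (pd 1 (pd 0 u)) r θ)
    (radialPart (pd 0 (pd 1 u)) (pd 1 (pd 1 u)) r θ)
  have h2 := Complex.sq_norm_rotate θ (angularPart (pd 0 (pd 0 u)) (pd 1 (pd 0 u)) r θ)
    (angularPart (pd 0 (pd 1 u)) (pd 1 (pd 1 u)) r θ)
  have h3 := fun i => Complex.sq_norm_rotate θ (pd 0 (pd i u) (polarPoint r θ))
    (pd 1 (pd i u) (polarPoint r θ))
  rw [← hessMixed_eq hu] at h2
  simp only [← radialPart.eq_1, ← angularPart.eq_1, ← hessRadial.eq_1, ← hessMixed.eq_1,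
    ← hessAngular.eq_1] at h1 h2 h3
  simp only [hessSq, Fin.sum_univ_two]
  linear_combination -h1 - h2 - h3 0 - h3 1

lemma lap_polarPoint (u : E2 → ℂ) (r θ : ℝ) :
    hessRadial u r θ + hessAngular u r θ = lap u (polarPoint r θ) := by
  have h : (Real.sin θ : ℂ) ^ 2 + (Real.cos θ : ℂ) ^ 2 = 1 := by
    exact_mod_cast Real.sin_sq_add_cos_sq θ
  simp only [hessRadial, hessAngular, radialPart, angularPart, lap]
  linear_combination (pd 0 (pd 0 u) (polarPoint r θ) + pd 1 (pd 1 u) (polarPoint r θ)) * h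

lemma continuous_hessSq {u : E2 → ℂ} (hu : ContDiff ℝ 2 u) : Continuous (hessSq u) :=
  continuous_finsetSum _ fun i _ => continuous_finsetSum _ fun j _ =>
    (continuous_pd_pd hu i j).norm.pow 2

lemma continuous_gradSq {u : E2 → ℂ} (hu : ContDiff ℝ 1 u) : Continuous (gradSq u) :=
  continuous_finsetSum _ fun i _ => (continuous_pd_of_contDiff hu i).norm.pow 2

lemma continuous_lap {u : E2 → ℂ} (hu : ContDiff ℝ 2 u) : Continuous (lap u) :=
  (continuous_pd_pd hu 0 0).add (continuous_pd_pd hu 1 1)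

lemma integral_critical_form_nonneg {u : E2 → ℂ} (hu : ContDiff ℝ 2 u) {R : ℝ} (hR : 0 < R) :
    0 ≤ ∫ x in Metric.ball (0 : E2) R,
      (4 * hessSq u x - 3 * ‖lap u x‖ ^ 2 + 1000 * R⁻¹ ^ 4 * ‖u x‖ ^ 2) := by
  have hH := continuous_hessSq hu
  have hL := continuous_lap hu
  have hu0 := hu.continuous
  have ca := continuous_hessRadial hu
  have cd := continuous_hessAngular hu
  refine integral_ball_nonneg_of_angularCoeff hR ![4, 8, 4, -3, 1000 * R⁻¹ ^ 4]
    (F := ![hessRadial u, hessMixed u, hessAngular u,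
      fun r θ => hessRadial u r θ + hessAngular u r θ, fun r θ => u (polarPoint r θ)])
    (fun i => ?_) (by fun_prop) (fun r θ => ?_) fun n => ?_
  · fin_cases i
    exacts [ca, continuous_hessMixed hu, cd, ca.add cd, hu0.comp continuous_polarPoint]
  · simp [Fin.sum_univ_five, hessSq_polarPoint hu, lap_polarPoint]
    ring
  · refine ((isPolarMode_angularCoeff hu n).critical_form_ge hR).trans_eq
      (intervalIntegral.integral_congr fun r _ => ?_)
    have := angularCoeff_add n (ca.comp (Continuous.prodMk_right r))
      (cd.comp (Continuous.prodMk_right r))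
    simp only [Function.comp_def, Function.uncurry_apply_pair] at this
    simp only [Fin.sum_univ_five, Matrix.cons_val, this]
    ring

lemma integral_gradSq_le {u : E2 → ℂ} (hu : ContDiff ℝ 2 u) {R : ℝ} (hR : 0 < R) :
    0 ≤ ∫ x in Metric.ball (0 : E2) R,
      (12 * R⁻¹ ^ 2 * ‖u x‖ ^ 2 + 5 * R ^ 2 * hessSq u x - gradSq u x) := by
  have hu1 : ContDiff ℝ 1 u := hu.of_le one_le_two
  have hH := continuous_hessSq hu
  have hG := continuous_gradSq hu1
  have hu0 := hu.continuous
  have c₀ := continuous_pd_of_contDiff hu1 0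
  have c₁ := continuous_pd_of_contDiff hu1 1
  refine integral_ball_nonneg_of_angularCoeff hR
    ![5 * R ^ 2, 10 * R ^ 2, 5 * R ^ 2, 12 * R⁻¹ ^ 2, -1, -1]
    (F := ![hessRadial u, hessMixed u, hessAngular u, fun r θ => u (polarPoint r θ),
      radialPart (pd 0 u) (pd 1 u), angularPart (pd 0 u) (pd 1 u)])
    (fun i => ?_) (by fun_prop) (fun r θ => ?_) fun n => ?_
  · fin_cases i
    exacts [continuous_hessRadial hu, continuous_hessMixed hu, continuous_hessAngular hu,
      hu0.comp continuous_polarPoint, continuous_radialPart c₀ c₁, continuous_angularPart c₀ c₁]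
  · simp [Fin.sum_univ_six, hessSq_polarPoint hu, gradSq_polarPoint]
    ring
  · refine ((isPolarMode_angularCoeff hu n).gradient_le hR).trans_eq
      (intervalIntegral.integral_congr fun r _ => ?_)
    simp only [Fin.sum_univ_six, Matrix.cons_val]
    ring

lemma pd_congr {f g : E2 → ℂ} {x : E2} (h : f =ᶠ[nhds x] g) (i : Fin 2) :
    pd i f =ᶠ[nhds x] pd i g :=
  (h.fderiv (𝕜 := ℝ)).fun_comp fun L => L (EuclideanSpace.single i 1)

lemma exists_contDiff_eqOn_nhds {u : E2 → ℂ} {R : ℝ} {V : Set E2} (hV : IsOpen V)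
    (hRV : Metric.closedBall 0 R ⊆ V) (hu : ContDiffOn ℝ 2 u V) :
    ∃ w : E2 → ℂ, ContDiff ℝ 2 w ∧ ∀ x ∈ Metric.closedBall (0 : E2) R, u =ᶠ[nhds x] w := by
  obtain ⟨K, hK, hRK, hKV⟩ := exists_compact_between (isCompact_closedBall (0 : E2) R) hV hRV
  obtain ⟨L, hL, hKL, hLV⟩ := exists_compact_between hK hV hKV
  obtain ⟨χ, hχ, -, hχ0, hχ1⟩ := exists_contMDiff_support_eq_eq_one_iff
    (modelWithCornersSelf ℝ E2) (n := 2) isOpen_interior hK.isClosed hKL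
  refine ⟨fun x => χ x • u x, contDiff_iff_contDiffAt.2 fun x => ?_, fun x hx => ?_⟩
  · by_cases hx : x ∈ V
    · exact hχ.contDiff.contDiffAt.smul (hu.contDiffAt (hV.mem_nhds hx))
    · refine contDiffAt_const (c := (0 : ℂ)) |>.congr_of_eventuallyEq ?_
      filter_upwards [hL.isClosed.isOpen_compl.mem_nhds fun h => hx (hLV h)] with y hy
      have : χ y = 0 := Function.notMem_support.1
        (hχ0 ▸ fun h => hy (interior_subset h))
      rw [this, zero_smul]
  · filter_upwards [isOpen_interior.mem_nhds (hRK hx)] with y hy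
    rw [(hχ1 y).1 (interior_subset hy), one_smul]

/-- Gårding inequality for the Kirchhoff–Love plate energy form on
`B_R`, for `μ ∈ (−3, 1)`, restricted to functions `C²` on a neighborhood of the
closed ball. -/
theorem garding_inequality_plate (R : ℝ) (hR : 0 < R) (μ : ℝ) (hμ1 : -3 < μ) (hμ2 : μ < 1) :
    ∃ c₀ > (0 : ℝ), ∃ lam₀ ≥ (0 : ℝ), ∀ u : E2 → ℂ,
      (∃ V : Set E2, IsOpen V ∧ Metric.closedBall (0 : E2) R ⊆ V ∧ ContDiffOn ℝ 2 u V) →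
      c₀ * ∫ x in Metric.ball (0 : E2) R,
            (‖u x‖ ^ 2 + ∑ i : Fin 2, ‖pd i u x‖ ^ 2
              + ∑ i : Fin 2, ∑ j : Fin 2, ‖pd i (pd j u) x‖ ^ 2)
        ≤ (∫ x in Metric.ball (0 : E2) R,
              (μ * ‖lap u x‖ ^ 2
                + (1 - μ) * ∑ i : Fin 2, ∑ j : Fin 2, ‖pd i (pd j u) x‖ ^ 2))
          + lam₀ * ∫ x in Metric.ball (0 : E2) R, ‖u x‖ ^ 2 := by
  obtain ⟨t, κ, ht, hκ, htκ⟩ : ∃ t κ : ℝ, 0 ≤ t ∧ 0 < κ ∧ ∀ H L : ℝ, 0 ≤ L →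
      t * (4 * H - 3 * L) + κ * H ≤ μ * L + (1 - μ) * H := by
    rcases le_total 0 μ with h | h
    · exact ⟨0, 1 - μ, le_rfl, by linarith, fun H L hL => by nlinarith [mul_nonneg h hL]⟩
    · exact ⟨-μ / 3, 1 + μ / 3, by linarith, by linarith, fun H L _ => by linarith⟩
  have hc : 0 < κ / (1 + 5 * R ^ 2) := by positivity
  obtain ⟨c, hcdef⟩ : ∃ c, c = κ / (1 + 5 * R ^ 2) := ⟨_, rfl⟩
  rw [← hcdef] at hc
  have hcκ : c * (1 + 5 * R ^ 2) = κ := by rw [hcdef]; field_simp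
  refine ⟨c, hc, c * (1 + 12 * R⁻¹ ^ 2) + t * (1000 * R⁻¹ ^ 4), by positivity, ?_⟩
  rintro u ⟨V, hV, hRV, hu⟩
  obtain ⟨w, hw, huw⟩ := exists_contDiff_eqOn_nhds hV hRV hu
  have hball : ∀ x ∈ Metric.ball (0 : E2) R, u x = w x ∧ lap u x = lap w x ∧
      (∀ i, pd i u x = pd i w x) ∧ ∀ i j, pd i (pd j u) x = pd i (pd j w) x := fun x hx => by
    have h := huw x (Metric.ball_subset_closedBall hx)
    have h2 := fun i j => (pd_congr (pd_congr h j) i).eq_of_nhds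
    exact ⟨h.eq_of_nhds, by simp only [lap, h2], fun i => (pd_congr h i).eq_of_nhds, h2⟩
  have hw1 : ContDiff ℝ 1 w := hw.of_le one_le_two
  have hint : ∀ {f : E2 → ℝ}, Continuous f → IntegrableOn f (Metric.ball (0 : E2) R) := fun hf =>
    (hf.continuousOn.integrableOn_compact (isCompact_closedBall _ _)).mono_set
      Metric.ball_subset_closedBall
  have c0 : Continuous fun x => ‖w x‖ ^ 2 := hw.continuous.norm.pow 2
  have cL : Continuous fun x => ‖lap w x‖ ^ 2 := (continuous_lap hw).norm.pow 2
  have cH := continuous_hessSq hw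
  have cG := continuous_gradSq hw1
  have hcrit := mul_nonneg ht (integral_critical_form_nonneg hw hR)
  have hgrad := mul_nonneg hc.le (integral_gradSq_le hw hR)
  change c * ∫ x in Metric.ball (0 : E2) R, (‖u x‖ ^ 2 + gradSq u x + hessSq u x)
    ≤ (∫ x in Metric.ball (0 : E2) R, (μ * ‖lap u x‖ ^ 2 + (1 - μ) * hessSq u x)) + _
  have h1 : Set.EqOn (fun x => ‖u x‖ ^ 2 + gradSq u x + hessSq u x)
      (fun x => ‖w x‖ ^ 2 + gradSq w x + hessSq w x) (Metric.ball 0 R) := fun x hx => by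
    simp only [hball x hx, gradSq, hessSq]
  have h2 : Set.EqOn (fun x => μ * ‖lap u x‖ ^ 2 + (1 - μ) * hessSq u x)
      (fun x => μ * ‖lap w x‖ ^ 2 + (1 - μ) * hessSq w x) (Metric.ball 0 R) := fun x hx => by
    simp only [hball x hx, hessSq]
  have h3 : Set.EqOn (fun x => ‖u x‖ ^ 2) (fun x => ‖w x‖ ^ 2) (Metric.ball 0 R) := fun x hx => by
    simp only [hball x hx]
  rw [setIntegral_congr_fun measurableSet_ball h1, setIntegral_congr_fun measurableSet_ball h2,
    setIntegral_congr_fun measurableSet_ball h3]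
  rw [← integral_const_mul] at hcrit hgrad ⊢
  rw [← integral_const_mul, ← integral_add (hint (by fun_prop)) (hint (by fun_prop))]
  refine le_trans (le_add_of_nonneg_right (add_nonneg hcrit hgrad)) ?_
  rw [← integral_add (hint (by fun_prop)) (hint (by fun_prop)),
    ← integral_add (hint (by fun_prop)) (hint (by fun_prop))]
  refine setIntegral_mono (hint (by fun_prop)) (hint (by fun_prop)) fun x => ?_
  have := htκ (hessSq w x) (‖lap w x‖ ^ 2) (by positivity)
  linear_combination this + hessSq w x * hcκ
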